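/- Assume hypotheses (*) and (H2), and suppose a = a(k) ∈ (0,∞) satisfies lim_{k→∞} a(k) S_0(k,a(k)) = 0. Suppose given, for each large k and for z ∈ D_{a(k)} ∩ B_δ(1), analytic families λ′(z) ∈ ℂ and P′(z) of bounded rank-one projections on B(Y) with R′(z)P′(z) = P′(z)R′(z) = λ′(z)P′(z), λ′(1) = 1, P′(1) = P, and uniform bounds |λ′(z)| ≤ C₀, ‖P′(z)‖ ≤ C₀. Define R′_1(z) = (z−1)^{−1}(R′(z) − R′(1)) for z ≠ 1 (extended analytically by R′_1(1) = (dR′/dz)(1)) and R̃′(z) = R′_1(z) − R′_1(1); define P′_1(z), λ′_1(z), λ̃′(z) analogously from P′ and λ′. Then there exist δ > 0, k₀ ≥ 1 and C > 0 such that for all k ≥ k₀ and all z ∈ D_{a(k)} ∩ B_δ(1): (a) ‖P′_1(z)‖ ≤ C ‖R′_1(z)‖ and |λ′_1(z)| ≤ C ‖R′_1(z)‖; (b) |λ̃′(z)| ≤ C ( ‖R̃′(z)‖ + |z−1| ‖R′_1(z)‖² ). -/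

import Mathlib

noncomputable section

open MeasureTheory Filter Set Metric
open scoped Topology ENNReal NNReal

variable {B : Type} [NormedAddCommGroup B] [NormedSpace ℂ B] [CompleteSpace B]

/-- `R(z) = ∑_{n≥1} Rₙ zⁿ` (here `R₀ = 0` is assumed throughout). -/
def Rcal (Rn : ℕ → B →L[ℂ] B) (z : ℂ) : B →L[ℂ] B :=
  ∑' n : ℕ, z ^ n • Rn n

/-- tail sum `U_j = ∑_{ℓ>j} R_ℓ`. -/
def Utail (Rn : ℕ → B →L[ℂ] B) (j : ℕ) : B →L[ℂ] B :=
  ∑' ℓ : ℕ, Rn (j + 1 + ℓ)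

/-- the truncated operators `R'_n` corresponding to `φ' = min (φ, k)`:
`R'_n = R_n` for `n < k`, `R'_k = ∑_{j≥k} R_j`, and `R'_n = 0` for `n > k`. -/
def Rntr (Rn : ℕ → B →L[ℂ] B) (k n : ℕ) : B →L[ℂ] B :=
  if n < k then Rn n else if n = k then ∑' ℓ : ℕ, Rn (k + ℓ) else 0

/-- the truncated series `R'(z) = ∑_{n=1}^{k} zⁿ R'_n`. -/
def Rcaltr (Rn : ℕ → B →L[ℂ] B) (k : ℕ) (z : ℂ) : B →L[ℂ] B :=
  ∑ n ∈ Finset.range (k + 1), z ^ n • Rntr Rn k n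

/-- `S_q(k,a) = ∑_{j=1}^{k} (∑_{ℓ>j} ‖R_ℓ‖) j^q e^{j a}`. -/
def Sq (Rn : ℕ → B →L[ℂ] B) (q : ℝ) (k : ℕ) (a : ℝ) : ℝ :=
  ∑ j ∈ Finset.Icc 1 k, (∑' ℓ : ℕ, ‖Rn (j + 1 + ℓ)‖) * (j : ℝ) ^ q * Real.exp ((j : ℝ) * a)

/-- `R'_1(z) = (z-1)⁻¹ (R'(z) - R'(1)) = ∑_{j=0}^{k-1} U_j z^j`. -/
def R1tr (Rn : ℕ → B →L[ℂ] B) (k : ℕ) (z : ℂ) : B →L[ℂ] B :=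
  ∑ j ∈ Finset.range k, z ^ j • Utail Rn j

/-- `R̃'(z) = R'_1(z) - R'_1(1)`. -/
def Rttr (Rn : ℕ → B →L[ℂ] B) (k : ℕ) (z : ℂ) : B →L[ℂ] B :=
  R1tr Rn k z - R1tr Rn k 1

/-! ### Perturbation of a rank-one spectral projection in a normed algebra -/

section Perturbation

variable {𝔸 : Type*} [NormedRing 𝔸]

theorem one_le_norm_of_mul_self_eq {Q : 𝔸} (hQ : Q * Q = Q) (h0 : Q ≠ 0) : 1 ≤ ‖Q‖ := by
  have h := norm_mul_le Q Q
  rw [hQ] at h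
  have : 0 < ‖Q‖ := norm_pos_iff.2 h0
  nlinarith

variable [NormedAlgebra ℂ 𝔸]

/-- An eigenvalue of `A + X` that is close to the simple eigenvalue `1` of `A` is at distance
`O(‖X‖)` from it. -/
theorem norm_eigenvalue_sub_one_le {A P G Q X : 𝔸} {l : ℂ} {g p : ℝ}
    (hPA : P * A = P) (hG : G * (1 - A + P) = 1) (hQ : (A + X) * Q = l • Q) (hQ0 : Q ≠ 0)
    (hg : ‖G‖ ≤ g) (hp : ‖P‖ ≤ p) (hl : g * ‖l - 1‖ ≤ 1 / 4) (hX : g * ‖X‖ ≤ 1 / 4) :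
    ‖l - 1‖ ≤ 2 * g * p * ‖X‖ := by
  have hQpos : 0 < ‖Q‖ := norm_pos_iff.2 hQ0
  have hg0 : 0 ≤ g := (norm_nonneg _).trans hg
  have hp0 : 0 ≤ p := (norm_nonneg _).trans hp
  have hAQ : A * Q = l • Q - X * Q := by rw [← hQ]; noncomm_ring
  have hrep : Q = G * (P * Q + (X * Q - (l - 1) • Q)) := by
    calc Q = (G * (1 - A + P)) * Q := by rw [hG, one_mul]
      _ = G * (Q - A * Q + P * Q) := by noncomm_ring
      _ = _ := by rw [hAQ, sub_smul, one_smul]; congr 1; abel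
  have hlow : ‖Q‖ ≤ 2 * g * ‖P * Q‖ := by
    have h1 : ‖Q‖ ≤ g * (‖P * Q‖ + (‖X‖ * ‖Q‖ + ‖l - 1‖ * ‖Q‖)) := by
      conv_lhs => rw [hrep]
      refine (norm_mul_le _ _).trans ?_
      gcongr
      refine (norm_add_le _ _).trans ?_
      gcongr
      refine (norm_sub_le _ _).trans ?_
      rw [norm_smul]
      gcongr
      exact norm_mul_le _ _
    nlinarith
  have hPQ : 0 < ‖P * Q‖ := by
    by_contra! h
    nlinarith [norm_nonneg (P * Q)]
  have heq : (l - 1) • (P * Q) = P * X * Q := by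
    have h1 : P * ((A + X) * Q) = l • (P * Q) := by rw [hQ, mul_smul_comm]
    have h2 : P * ((A + X) * Q) = P * A * Q + P * X * Q := by noncomm_ring
    rw [sub_smul, one_smul, ← h1, h2, hPA]
    abel
  have hn : ‖l - 1‖ * ‖P * Q‖ ≤ p * ‖X‖ * ‖Q‖ := by
    rw [← norm_smul, heq]
    refine (norm_mul_le _ _).trans ?_
    gcongr
    refine (norm_mul_le _ _).trans ?_
    gcongr
  have h2 : p * ‖X‖ * ‖Q‖ ≤ p * ‖X‖ * (2 * g * ‖P * Q‖) := by gcongr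
  refine le_of_mul_le_mul_right ?_ hPQ
  nlinarith

/-- The spectral projection `Q` of `A + X` for an eigenvalue at distance `O(‖X‖)` from the simple
eigenvalue `1` of `A` is at distance `O(‖X‖)` from the spectral projection `P` of `A`. -/
theorem norm_projection_sub_le {A P G Q X : 𝔸} {l c : ℂ} {p q d : ℝ}
    (hPA : P * A = P) (hAP : A * P = P) (hPP : P * P = P) (hP0 : P ≠ 0)
    (hG : G * (1 - A + P) = 1) (hG' : (1 - A + P) * G = 1)
    (hQ : (A + X) * Q = l • Q) (hQ' : Q * (A + X) = l • Q) (hQQ : Q * Q = Q) (hQ0 : Q ≠ 0)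
    (hp : ‖P‖ ≤ p) (hq : ‖Q‖ ≤ q) (hc : P * Q * P = c • P)
    (hd : ‖G‖ * ((‖l - 1‖ + ‖X‖) * q) ≤ d) (hsmall : (1 + p) * d ≤ 1 / 2) :
    ‖Q - P‖ ≤ ((1 + p) + 2 * p ^ 4 * q) * d := by
  have hP1 := one_le_norm_of_mul_self_eq hPP hP0
  have hQ1 := one_le_norm_of_mul_self_eq hQQ hQ0
  have hp1 : 1 ≤ p := hP1.trans hp
  have hq1 : 1 ≤ q := hQ1.trans hq
  have hAQ : A * Q = l • Q - X * Q := by rw [← hQ]; noncomm_ring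
  have hQA : Q * A = l • Q - Q * X := by rw [← hQ']; noncomm_ring
  have hleft : Q - P * Q = G * (X * Q - (l - 1) • Q) := by
    calc Q - P * Q = G * (1 - A + P) * (Q - P * Q) := by rw [hG, one_mul]
      _ = G * (Q - A * Q + A * P * Q - P * P * Q + P * Q - P * Q) := by noncomm_ring
      _ = _ := by rw [hAP, hPP, hAQ, sub_smul, one_smul]; congr 1; abel
  have hright : Q - Q * P = (Q * X - (l - 1) • Q) * G := by
    calc Q - Q * P = (Q - Q * P) * ((1 - A + P) * G) := by rw [hG', mul_one]
      _ = (Q - Q * A + Q * (P * A) - Q * (P * P) + Q * P - Q * P) * G := by noncomm_ring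
      _ = _ := by rw [hPA, hPP, hQA, sub_smul, one_smul]; congr 1; abel
  have hleftn : ‖Q - P * Q‖ ≤ d := by
    rw [hleft]
    refine (norm_mul_le _ _).trans (le_trans ?_ hd)
    gcongr
    refine (norm_sub_le _ _).trans ?_
    rw [norm_smul]
    have : ‖X * Q‖ ≤ ‖X‖ * q := (norm_mul_le _ _).trans (by gcongr)
    have : ‖l - 1‖ * ‖Q‖ ≤ ‖l - 1‖ * q := by gcongr
    linarith
  have hrightn : ‖Q - Q * P‖ ≤ d := by
    rw [hright]
    refine (norm_mul_le _ _).trans (le_trans ?_ hd)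
    rw [mul_comm]
    gcongr
    refine (norm_sub_le _ _).trans ?_
    rw [norm_smul]
    have : ‖Q * X‖ ≤ q * ‖X‖ := (norm_mul_le _ _).trans (by gcongr)
    have : ‖l - 1‖ * ‖Q‖ ≤ ‖l - 1‖ * q := by gcongr
    linarith
  have hd0 : 0 ≤ d := (norm_nonneg _).trans hleftn
  have hE : ‖Q - c • P‖ ≤ (1 + p) * d := by
    have : Q - c • P = (Q - P * Q) + P * (Q - Q * P) := by rw [← hc]; noncomm_ring
    rw [this]
    refine (norm_add_le _ _).trans ?_
    have : ‖P * (Q - Q * P)‖ ≤ p * d := (norm_mul_le _ _).trans (by gcongr)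
    linarith
  have hclow : 1 / 2 ≤ ‖c‖ * p := by
    have h1 : ‖Q‖ ≤ ‖Q - c • P‖ + ‖c • P‖ := by
      simpa using norm_add_le (Q - c • P) (c • P)
    have h2 : ‖c • P‖ ≤ ‖c‖ * p := by rw [norm_smul]; gcongr
    linarith
  have hcc : ‖c‖ * ‖1 - c‖ ≤ p * q * d * p := by
    have heq : (c * (1 - c)) • P = P * Q * (Q - P * Q) * P := by
      have h1 : P * Q * (Q - P * Q) * P = P * (Q * Q) * P - (P * Q * P) * Q * P := by noncomm_ring
      rw [h1, hQQ, hc, smul_mul_assoc, smul_mul_assoc, hc, smul_smul, ← sub_smul]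
      congr 1
      ring
    have h1 : ‖c‖ * ‖1 - c‖ * ‖P‖ ≤ p * q * d * p := by
      rw [← norm_mul, ← norm_smul, heq]
      refine (norm_mul_le _ _).trans ?_
      gcongr
      refine (norm_mul_le _ _).trans ?_
      gcongr
      refine (norm_mul_le _ _).trans ?_
      gcongr
    have : 0 ≤ ‖c‖ * ‖1 - c‖ := by positivity
    nlinarith
  have hc1 : ‖1 - c‖ ≤ 2 * p ^ 3 * q * d := by
    have h1 : ‖1 - c‖ * (1 / 2) ≤ ‖1 - c‖ * (‖c‖ * p) := by gcongr
    have h2 : (‖c‖ * ‖1 - c‖) * p ≤ (p * q * d * p) * p := by gcongr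
    nlinarith
  have hfin : Q - P = (Q - c • P) - (1 - c) • P := by rw [sub_smul, one_smul]; abel
  rw [hfin]
  refine (norm_sub_le _ _).trans ?_
  have : ‖(1 - c) • P‖ ≤ (2 * p ^ 3 * q * d) * p := by rw [norm_smul]; gcongr
  linarith

end Perturbation

/-! ### Summation by parts for the truncated series -/

section Truncation

theorem sum_pow_smul_add_tail {𝕜 E : Type*} [NormedField 𝕜] [NormedAddCommGroup E]
    [NormedSpace 𝕜 E] {f : ℕ → E} (hf : Summable f) (z : 𝕜) (k : ℕ) :
    ∑ n ∈ Finset.range k, z ^ n • f n + z ^ k • ∑' l, f (k + l) =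
      ∑' l, f l + (z - 1) • ∑ j ∈ Finset.range k, z ^ j • ∑' l, f (j + 1 + l) := by
  induction k with
  | zero => simp
  | succ k ih =>
    have hs : Summable fun l => f (k + l) := by
      simpa only [add_comm] using (summable_nat_add_iff k).2 hf
    have htail : ∑' l, f (k + l) = f k + ∑' l, f (k + 1 + l) := by
      rw [hs.tsum_eq_zero_add]
      simp [add_assoc, add_comm 1]
    rw [Finset.sum_range_succ, Finset.sum_range_succ, smul_add, ← add_assoc, ← ih, htail]
    module

variable {E : Type} [NormedAddCommGroup E] [NormedSpace ℂ E]

theorem Rcal_one (Rn : ℕ → E →L[ℂ] E) : Rcal Rn 1 = ∑' n, Rn n := by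
  simp [Rcal]

theorem Rcaltr_eq_sum_add_tail (Rn : ℕ → E →L[ℂ] E) (k : ℕ) (z : ℂ) :
    Rcaltr Rn k z =
      ∑ n ∈ Finset.range k, z ^ n • Rn n + z ^ k • ∑' l, Rn (k + l) := by
  rw [Rcaltr, Finset.sum_range_succ]
  congr 1
  · refine Finset.sum_congr rfl fun n hn => ?_
    simp [Rntr, Finset.mem_range.1 hn]
  · simp [Rntr]

theorem Rcaltr_eq_add_smul_R1tr [CompleteSpace E] {Rn : ℕ → E →L[ℂ] E}
    (hf : Summable fun n => ‖Rn n‖) (k : ℕ) (z : ℂ) :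
    Rcaltr Rn k z = Rcal Rn 1 + (z - 1) • R1tr Rn k z := by
  rw [Rcaltr_eq_sum_add_tail, Rcal_one, sum_pow_smul_add_tail hf.of_norm]
  rfl

theorem summable_norm_tail {Rn : ℕ → E →L[ℂ] E} (hf : Summable fun n => ‖Rn n‖) (k : ℕ) :
    Summable fun l => ‖Rn (k + l)‖ := by
  simpa only [add_comm] using (summable_nat_add_iff k).2 hf

theorem norm_R1tr_le_of_norm_le_one {Rn : ℕ → E →L[ℂ] E} (hf : Summable fun n => ‖Rn n‖)
    (hstar : Summable fun n : ℕ => ∑' j : ℕ, ‖Rn (n + 1 + j)‖) (k : ℕ) {z : ℂ} (hz : ‖z‖ ≤ 1) :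
    ‖R1tr Rn k z‖ ≤ ∑' n : ℕ, ∑' j : ℕ, ‖Rn (n + 1 + j)‖ := by
  refine (norm_sum_le _ _).trans (le_trans (Finset.sum_le_sum fun j _ => ?_)
    (hstar.sum_le_tsum (Finset.range k) fun j _ => tsum_nonneg fun _ => norm_nonneg _))
  rw [norm_smul, norm_pow]
  exact (mul_le_of_le_one_left (norm_nonneg _) (pow_le_one₀ (norm_nonneg _) hz)).trans
    (norm_tsum_le_tsum_norm (summable_norm_tail hf _))

theorem sum_tail_mul_pow_le (Rn : ℕ → E →L[ℂ] E) (k : ℕ) {r a : ℝ} (hr : 0 ≤ r)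
    (hra : r ≤ Real.exp a) :
    ∑ j ∈ Finset.range k, r ^ j * ∑' l, ‖Rn (j + 1 + l)‖ ≤
      ∑' l, ‖Rn (0 + 1 + l)‖ + Sq Rn 0 k a := by
  have htail : ∀ j, 0 ≤ ∑' l, ‖Rn (j + 1 + l)‖ := fun j => tsum_nonneg fun _ => norm_nonneg _
  have hsub : Finset.range k ⊆ insert 0 (Finset.Icc 1 k) := by
    intro j hj
    simp only [Finset.mem_range, Finset.mem_insert, Finset.mem_Icc] at *
    omega
  refine (Finset.sum_le_sum_of_subset_of_nonneg hsub fun j _ _ =>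
    mul_nonneg (pow_nonneg hr _) (htail j)).trans ?_
  rw [Finset.sum_insert (by simp), pow_zero, one_mul, Sq]
  refine add_le_add le_rfl (Finset.sum_le_sum fun j _ => ?_)
  rw [Real.rpow_zero, mul_one, mul_comm, Real.exp_nat_mul]
  exact mul_le_mul_of_nonneg_left (pow_le_pow_left₀ hr hra j) (htail j)

theorem norm_Rcaltr_sub_le {Rn : ℕ → E →L[ℂ] E} (hf : Summable fun n => ‖Rn n‖) (k : ℕ)
    {r : ℝ} (hr : 1 ≤ r) {u : ℂ} (hu : ‖u‖ = 1) :
    ‖Rcaltr Rn k (r * u) - Rcaltr Rn k u‖ ≤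
      (r - 1) * ∑ j ∈ Finset.range k, r ^ j * ∑' l, ‖Rn (j + 1 + l)‖ := by
  have hpow : ∀ n : ℕ, ‖((r : ℂ) * u) ^ n - u ^ n‖ = r ^ n - 1 := by
    intro n
    have h : ((r : ℂ) * u) ^ n - u ^ n = ((r ^ n - 1 : ℝ) : ℂ) * u ^ n := by
      push_cast; ring
    rw [h, norm_mul, norm_pow, hu, one_pow, mul_one, Complex.norm_real, Real.norm_eq_abs,
      abs_of_nonneg (sub_nonneg.2 (one_le_pow₀ hr))]
  have hscalar := sum_pow_smul_add_tail (𝕜 := ℝ) hf r k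
  have hscalar1 := sum_pow_smul_add_tail (𝕜 := ℝ) hf 1 k
  simp only [smul_eq_mul, one_pow, one_mul, sub_self, zero_mul, add_zero] at hscalar hscalar1
  have hdiff : Rcaltr Rn k (r * u) - Rcaltr Rn k u =
      ∑ n ∈ Finset.range k, (((r : ℂ) * u) ^ n - u ^ n) • Rn n +
        (((r : ℂ) * u) ^ k - u ^ k) • ∑' l, Rn (k + l) := by
    simp only [Rcaltr_eq_sum_add_tail, sub_smul, Finset.sum_sub_distrib]
    abel
  rw [hdiff]
  calc _ ≤ ∑ n ∈ Finset.range k, (r ^ n - 1) * ‖Rn n‖ + (r ^ k - 1) * ∑' l, ‖Rn (k + l)‖ := by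
        refine (norm_add_le _ _).trans (add_le_add ((norm_sum_le _ _).trans ?_) ?_)
        · exact Finset.sum_le_sum fun n _ => by rw [norm_smul, hpow]
        · rw [norm_smul, hpow]
          exact mul_le_mul_of_nonneg_left (norm_tsum_le_tsum_norm (summable_norm_tail hf _))
            (sub_nonneg.2 (one_le_pow₀ hr))
    _ = _ := by
        simp only [sub_mul, one_mul, Finset.sum_sub_distrib] at *
        linarith

/-- `R'(z)` stays uniformly close to `R'(1)` on `D_a ∩ B_δ(1)`. -/
theorem norm_smul_R1tr_le [CompleteSpace E] {Rn : ℕ → E →L[ℂ] E}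
    (hf : Summable fun n => ‖Rn n‖)
    (hstar : Summable fun n : ℕ => ∑' j : ℕ, ‖Rn (n + 1 + j)‖) (k : ℕ) {a δ : ℝ} (ha : 0 < a)
    (hδ : δ ≤ 1) {z : ℂ} (hza : ‖z‖ < Real.exp a) (hzδ : ‖z - 1‖ < δ) :
    ‖(z - 1) • R1tr Rn k z‖ ≤
      3 * δ * (∑' n : ℕ, ∑' j : ℕ, ‖Rn (n + 1 + j)‖) + 2 * (a * Sq Rn 0 k a) := by
  set M := ∑' n : ℕ, ∑' j : ℕ, ‖Rn (n + 1 + j)‖ with hM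
  have htail : ∀ j, 0 ≤ ∑' l, ‖Rn (j + 1 + l)‖ := fun j => tsum_nonneg fun _ => norm_nonneg _
  have hM0 : 0 ≤ M := tsum_nonneg htail
  have hu0 : ∑' l, ‖Rn (0 + 1 + l)‖ ≤ M := hstar.le_tsum 0 fun j _ => htail j
  have hS : 0 ≤ Sq Rn 0 k a := Finset.sum_nonneg fun j _ => by
    have := htail j
    positivity
  have hδ0 : 0 < δ := (norm_nonneg _).trans_lt hzδ
  rcases le_total ‖z‖ 1 with hz | hz
  · have h1 : ‖(z - 1) • R1tr Rn k z‖ ≤ δ * M := by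
      rw [norm_smul]
      have := norm_R1tr_le_of_norm_le_one hf hstar k hz
      gcongr
    have : 0 ≤ δ * M := by positivity
    have : 0 ≤ a * Sq Rn 0 k a := by positivity
    linarith
  · set r := ‖z‖ with hr
    have hr0 : (r : ℂ) ≠ 0 := by exact_mod_cast (by linarith : r ≠ 0)
    set u : ℂ := z / r with hu
    have hzu : z = r * u := by rw [hu]; field_simp
    have hun : ‖u‖ = 1 := by
      rw [hu, norm_div, Complex.norm_real, norm_norm, div_self (by linarith)]
    have hr1 : r - 1 ≤ ‖z - 1‖ := by simpa using norm_sub_norm_le z 1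
    have hra : r - 1 ≤ 2 * a := by
      rcases le_total a 1 with h | h
      · have := Real.abs_exp_sub_one_le (x := a) (by rwa [abs_of_pos ha])
        rw [abs_of_pos ha] at this
        have := le_abs_self (Real.exp a - 1)
        linarith
      · linarith
    have hu1 : ‖u - 1‖ ≤ 2 * δ := by
      have h1 : ‖u - z‖ = r - 1 := by
        have : u - z = ((1 - r : ℝ) : ℂ) * u := by rw [hzu]; push_cast; ring
        rw [this, norm_mul, hun, mul_one, Complex.norm_real, Real.norm_eq_abs, abs_sub_comm,
          abs_of_nonneg (by linarith)]
      have h2 := norm_sub_le_norm_sub_add_norm_sub u z 1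
      linarith
    have hsplit : (z - 1) • R1tr Rn k z =
        (Rcaltr Rn k (r * u) - Rcaltr Rn k u) + (u - 1) • R1tr Rn k u := by
      rw [← hzu, Rcaltr_eq_add_smul_R1tr hf, Rcaltr_eq_add_smul_R1tr hf]
      abel
    have hA : ‖Rcaltr Rn k (r * u) - Rcaltr Rn k u‖ ≤ δ * M + 2 * a * Sq Rn 0 k a := by
      refine (norm_Rcaltr_sub_le hf k hz hun).trans ?_
      have h1 := sum_tail_mul_pow_le Rn k (by linarith : 0 ≤ r) hza.le
      have h2 : (r - 1) * ∑ j ∈ Finset.range k, r ^ j * ∑' l, ‖Rn (j + 1 + l)‖ ≤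
          (r - 1) * (M + Sq Rn 0 k a) :=
        mul_le_mul_of_nonneg_left (by linarith) (by linarith)
      have h3 : (r - 1) * M ≤ δ * M := by gcongr; linarith
      have h4 : (r - 1) * Sq Rn 0 k a ≤ 2 * a * Sq Rn 0 k a := by gcongr
      linarith
    have hB : ‖(u - 1) • R1tr Rn k u‖ ≤ 2 * δ * M := by
      rw [norm_smul]
      have := norm_R1tr_le_of_norm_le_one hf hstar k hun.le
      gcongr
    rw [hsplit]
    refine (norm_add_le _ _).trans ?_
    linarith

theorem continuous_R1tr (Rn : ℕ → E →L[ℂ] E) (k : ℕ) : Continuous (R1tr Rn k) := by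
  unfold R1tr
  fun_prop

end Truncation

/-! ### Difference quotients -/

theorem AnalyticOnNhd.dslope_of_isOpen {E : Type*} [NormedAddCommGroup E] [NormedSpace ℂ E]
    [CompleteSpace E] {f : ℂ → E} {s : Set ℂ} {c : ℂ} (hf : AnalyticOnNhd ℂ f s) (hs : IsOpen s)
    (hc : c ∈ s) : AnalyticOnNhd ℂ (dslope f c) s :=
  ((Complex.differentiableOn_dslope (hs.mem_nhds hc)).2 hf.differentiableOn).analyticOnNhd hs

/-- A closed relation between functions continuous at `c` passes from a punctured neighbourhood
to `c`. -/
theorem le_at_of_le_punctured {f g : ℂ → ℝ} {s : Set ℂ} {c : ℂ} (hs : s ∈ 𝓝 c)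
    (hf : ContinuousAt f c) (hg : ContinuousAt g c) (h : ∀ z ∈ s, z ≠ c → f z ≤ g z) :
    f c ≤ g c := by
  refine le_of_tendsto_of_tendsto (hf.tendsto.mono_left nhdsWithin_le_nhds)
    (hg.tendsto.mono_left nhdsWithin_le_nhds) (b := 𝓝[≠] c) ?_
  filter_upwards [mem_nhdsWithin_of_mem_nhds hs, self_mem_nhdsWithin] with z hz hzc
  exact h z hz hzc

/-! ### Continuation of the estimates along a connected set -/

section Continuation

variable {𝔸 : Type*} [NormedRing 𝔸]

theorem IsPreconnected.norm_le_of_norm_ne {X E : Type*} [TopologicalSpace X]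
    [SeminormedAddCommGroup E] {s : Set X} (hs : IsPreconnected s) {f : X → E}
    (hf : ContinuousOn f s) {x₀ : X} (hx₀ : x₀ ∈ s) {b : ℝ} (hb : ‖f x₀‖ ≤ b)
    (hne : ∀ x ∈ s, ‖f x‖ ≠ b) {x : X} (hx : x ∈ s) : ‖f x‖ ≤ b := by
  by_contra! h
  obtain ⟨y, hy, hyb⟩ := hs.intermediate_value hx₀ hx hf.norm ⟨hb, h.le⟩
  exact hne y hy hyb

theorem IsPreconnected.ne_zero_of_mul_self_eq {X : Type*} [TopologicalSpace X] {s : Set X}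
    (hs : IsPreconnected s) {Q : X → 𝔸} (hQ : ContinuousOn Q s) (hQQ : ∀ x ∈ s, Q x * Q x = Q x)
    {x₀ : X} (hx₀ : x₀ ∈ s) (h0 : Q x₀ ≠ 0) {x : X} (hx : x ∈ s) : Q x ≠ 0 := by
  intro hx0
  have h1 := one_le_norm_of_mul_self_eq (hQQ _ hx₀) h0
  obtain ⟨y, hy, hyb⟩ := hs.intermediate_value hx hx₀ hQ.norm
    (show (1 / 2 : ℝ) ∈ Icc ‖Q x‖ ‖Q x₀‖ from ⟨by norm_num [hx0], by linarith⟩)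
  have h0 : Q y ≠ 0 := by
    intro h
    norm_num [h] at hyb
  linarith [one_le_norm_of_mul_self_eq (hQQ y hy) h0]

variable [NormedAlgebra ℂ 𝔸]

/-- Uniform Lipschitz bounds for the perturbed leading eigenvalue and its projection, as long as
the perturbation stays below a threshold depending only on the unperturbed operator and the bound
on the projections. -/
theorem exists_perturbation_bounds {A P G : 𝔸} (hPA : P * A = P) (hAP : A * P = P)
    (hPP : P * P = P) (hP0 : P ≠ 0) (hG : G * (1 - A + P) = 1) (hG' : (1 - A + P) * G = 1)
    (hrank : ∀ T : 𝔸, ∃ c : ℂ, P * T * P = c • P) {q : ℝ} (hq : 0 ≤ q) :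
    ∃ ε K : ℝ, 0 < ε ∧ 0 ≤ K ∧ ∀ (s : Set ℂ), IsPreconnected s → ∀ z₀ ∈ s,
      ∀ (l : ℂ → ℂ) (Q X : ℂ → 𝔸), ContinuousOn l s → ContinuousOn Q s → l z₀ = 1 → Q z₀ = P →
      (∀ z ∈ s, (A + X z) * Q z = l z • Q z ∧ Q z * (A + X z) = l z • Q z ∧
        Q z * Q z = Q z ∧ ‖Q z‖ ≤ q ∧ ‖X z‖ ≤ ε) →
      ∀ z ∈ s, ‖l z - 1‖ ≤ K * ‖X z‖ ∧ ‖Q z - P‖ ≤ K * ‖X z‖ := by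
  set p := ‖P‖
  set g := ‖G‖ + 1
  have hp : 1 ≤ p := one_le_norm_of_mul_self_eq hPP hP0
  have hg : 1 ≤ g := by simp [g]
  have hGg : ‖G‖ ≤ g := by simp [g]
  set K₁ := 2 * g * p
  set D := g * ((K₁ + 1) * q)
  set K₂ := ((1 + p) + 2 * p ^ 4 * q) * D
  have hK₁ : 0 < K₁ := by positivity
  have hD : 0 ≤ D := by positivity
  have hK₂ : 0 ≤ K₂ := by positivity
  set b := 1 / (4 * g)
  have hb0 : 0 < b := by positivity
  have hb : g * b = 1 / 4 := by simp only [b]; field_simp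
  set L := 1 + K₁ / b + 2 * ((1 + p) * D) + 4 * g
  have hL : 0 < L := by positivity
  refine ⟨1 / (2 * L), max K₁ K₂, by positivity, hK₁.le.trans (le_max_left _ _), ?_⟩
  intro s hs z₀ hz₀ l Q X hl hQ hl₀ hQ₀ h z hz
  have hsmall : ∀ {x y : ℝ}, 0 ≤ y → x ≤ 1 / (2 * L) → y ≤ L → y * x ≤ 1 / 2 := by
    intro x y hy hx hyL
    calc y * x ≤ y * (1 / (2 * L)) := by gcongr
      _ ≤ L * (1 / (2 * L)) := by gcongr
      _ = 1 / 2 := by field_simp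
  have hQ0 : ∀ w ∈ s, Q w ≠ 0 := fun w hw =>
    hs.ne_zero_of_mul_self_eq hQ (fun x hx => (h x hx).2.2.1) hz₀ (by rwa [hQ₀]) hw
  have hX : ∀ w ∈ s, g * ‖X w‖ ≤ 1 / 4 := fun w hw => by
    have hq1 : 0 ≤ K₁ / b := by positivity
    have hq2 : 0 ≤ 2 * ((1 + p) * D) := by positivity
    have := hsmall (y := 4 * g) (by positivity) (h w hw).2.2.2.2 (by simp only [L]; linarith)
    linarith
  have hK₁X : ∀ w ∈ s, K₁ * ‖X w‖ < b := fun w hw => by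
    have hq2 : 0 ≤ 2 * ((1 + p) * D) := by positivity
    have := hsmall (y := K₁ / b) (by positivity) (h w hw).2.2.2.2 (by simp only [L]; linarith)
    have h3 : K₁ / b * ‖X w‖ = K₁ * ‖X w‖ / b := by ring
    rw [h3, div_le_iff₀ hb0] at this
    linarith
  have hKl : ∀ w ∈ s, ‖l w - 1‖ ≤ b → ‖l w - 1‖ ≤ K₁ * ‖X w‖ := fun w hw hlw =>
    norm_eigenvalue_sub_one_le hPA hG (h w hw).1 (hQ0 w hw) hGg le_rfl
      ((mul_le_mul_of_nonneg_left hlw (by positivity)).trans hb.le) (hX w hw)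
  have hlb : ‖l z - 1‖ ≤ b := by
    refine hs.norm_le_of_norm_ne (f := fun w => l w - 1) (hl.sub continuousOn_const) hz₀
      (by simp [hl₀, hb0.le]) (fun w hw heq => ?_) hz
    exact absurd (hKl w hw heq.le) (by rw [heq]; exact not_le.2 (hK₁X w hw))
  have hlz := hKl z hz hlb
  obtain ⟨hz1, hz2, hz3, hz4, hz5⟩ := h z hz
  obtain ⟨c, hc⟩ := hrank (Q z)
  have hQz : ‖Q z - P‖ ≤ ((1 + p) + 2 * p ^ 4 * q) * (D * ‖X z‖) := by
    refine norm_projection_sub_le hPA hAP hPP hP0 hG hG' hz1 hz2 hz3 (hQ0 z hz) le_rfl hz4 hc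
      ?_ ?_
    · calc ‖G‖ * ((‖l z - 1‖ + ‖X z‖) * q) ≤ g * ((K₁ * ‖X z‖ + ‖X z‖) * q) := by gcongr
        _ = D * ‖X z‖ := by simp only [D]; ring
    · have hq1 : 0 ≤ K₁ / b := by positivity
      have := hsmall (y := (1 + p) * D) (by positivity) hz5 (by
        have : 0 ≤ (1 + p) * D := by positivity
        simp only [L]; linarith)
      linarith
  constructor
  · exact hlz.trans (by gcongr; exact le_max_left _ _)
  · rw [← mul_assoc] at hQz
    exact hQz.trans (by gcongr; exact le_max_right _ _)

/-- The second-order estimate for the difference quotient `l₁` of the leading eigenvalue, where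
`R₁`, `Q₁` and `l₁` are the values of the difference quotients at distance `t` from the base point
and `R₀`, `l₀` are their values at the base point. -/
theorem norm_quotient_sub_le {P Q₁ R₀ R₁ : 𝔸} {l₀ l₁ t : ℂ} {K : ℝ} (hPP : P * P = P)
    (hP0 : P ≠ 0) (hK : 0 ≤ K)
    (h₁ : l₁ • (P * (P + t • Q₁)) = P * R₁ * (P + t • Q₁)) (h₀ : l₀ • P = P * R₀ * P)
    (hl : ‖l₁‖ ≤ K * ‖R₁‖) (hQ : ‖Q₁‖ ≤ K * ‖R₁‖) :
    ‖l₁ - l₀‖ ≤ (‖P‖ ^ 2 + ‖P‖ * K + ‖P‖ * K ^ 2) * (‖R₁ - R₀‖ + ‖t‖ * ‖R₁‖ ^ 2) := by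
  have hP1 := one_le_norm_of_mul_self_eq hPP hP0
  have heq : (l₁ - l₀) • P =
      P * (R₁ - R₀) * P + t • (P * R₁ * Q₁) - t • (l₁ • (P * Q₁)) := by
    rw [mul_add, hPP, mul_smul_comm, mul_add, mul_smul_comm, smul_add] at h₁
    rw [sub_smul, h₀, mul_sub, sub_mul, eq_sub_iff_add_eq, smul_comm t l₁]
    calc _ = (l₁ • P + l₁ • t • (P * Q₁)) - P * R₀ * P := by abel
      _ = _ := by rw [h₁]; abel
  have e1 : ‖P * (R₁ - R₀) * P‖ ≤ ‖P‖ ^ 2 * ‖R₁ - R₀‖ := by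
    refine (norm_mul_le _ _).trans ((mul_le_mul_of_nonneg_right (norm_mul_le _ _)
      (norm_nonneg _)).trans (le_of_eq (by ring)))
  have e2 : ‖t • (P * R₁ * Q₁)‖ ≤ ‖P‖ * K * (‖t‖ * ‖R₁‖ ^ 2) := by
    rw [norm_smul]
    calc ‖t‖ * ‖P * R₁ * Q₁‖ ≤ ‖t‖ * (‖P‖ * ‖R₁‖ * (K * ‖R₁‖)) := by
          gcongr
          refine (norm_mul_le _ _).trans ?_
          gcongr
          exact norm_mul_le _ _
      _ = _ := by ring
  have e3 : ‖t • (l₁ • (P * Q₁))‖ ≤ ‖P‖ * K ^ 2 * (‖t‖ * ‖R₁‖ ^ 2) := by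
    rw [norm_smul, norm_smul]
    calc ‖t‖ * (‖l₁‖ * ‖P * Q₁‖) ≤ ‖t‖ * ((K * ‖R₁‖) * (‖P‖ * (K * ‖R₁‖))) := by
          gcongr
          refine (norm_mul_le _ _).trans ?_
          gcongr
      _ = _ := by ring
  have hle : ‖l₁ - l₀‖ ≤ ‖(l₁ - l₀) • P‖ := by
    rw [norm_smul]
    exact le_mul_of_one_le_right (norm_nonneg _) hP1
  have hsum := (norm_sub_le (P * (R₁ - R₀) * P + t • (P * R₁ * Q₁)) (t • (l₁ • (P * Q₁)))).trans
    (add_le_add_left (norm_add_le _ _) _)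
  rw [← heq] at hsum
  have f1 : 0 ≤ (‖P‖ * K + ‖P‖ * K ^ 2) * ‖R₁ - R₀‖ := by positivity
  have f2 : 0 ≤ ‖P‖ ^ 2 * (‖t‖ * ‖R₁‖ ^ 2) := by positivity
  linarith

end Continuation

/-- Proposition 3.3.  Assume (*) and (H2) and `a(k) S₀(k,a(k)) → 0`.
Given analytic families `λ'(z)`, `P'(z)` of simple eigenvalues and rank-one spectral
projections of `R'(z)` on `D_{a(k)} ∩ B_{δ₀}(1)` with `λ'(1) = 1`, `P'(1) = P` and uniform
bounds, there are `δ > 0`, `k₀ ≥ 1`, `C > 0` such that for all `k ≥ k₀` and all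
`z ∈ D_{a(k)} ∩ B_δ(1)`, the analytically extended difference quotients
`P'_1(z) = (z-1)⁻¹(P'(z) - P'(1))` and `λ'_1(z) = (z-1)⁻¹(λ'(z) - 1)` satisfy
(a) `‖P'_1(z)‖ ≤ C ‖R'_1(z)‖`, `|λ'_1(z)| ≤ C ‖R'_1(z)‖`, and
(b) `|λ̃'(z)| = |λ'_1(z) - λ'_1(1)| ≤ C (‖R̃'(z)‖ + |z-1| ‖R'_1(z)‖²)`. -/
theorem stmt_8
    {Y : Type} [MeasurableSpace Y] (μ : Measure Y) [IsProbabilityMeasure μ]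
    (F : Y → Y) (hFerg : Ergodic F μ)
    (φ : Y → ℕ) (hφmeas : Measurable φ) (hφ1 : ∀ y, 1 ≤ φ y)
    (hφint : Integrable (fun y => (φ y : ℝ)) μ)
    {B : Type} [NormedAddCommGroup B] [NormedSpace ℂ B] [CompleteSpace B]
    -- `B(Y) ⊆ L¹(Y)`, with `‖v‖₁ ≤ ‖v‖` and `1 ∈ B(Y)`
    (ι : B →L[ℂ] Lp ℂ 1 μ) (hι : ∀ b : B, ‖ι b‖ ≤ ‖b‖)
    (hιinj : Function.Injective fun b : B => ι b)
    (one : B) (hone : ⇑(ι one) =ᵐ[μ] fun _ => (1 : ℂ))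
    -- the transfer operator `R` of `F`
    (R : Lp ℂ 1 μ →L[ℂ] Lp ℂ 1 μ)
    (hR : ∀ (v : Lp ℂ 1 μ) (w : Y → ℂ), Measurable w → (∃ c, ∀ y, ‖w y‖ ≤ c) →
      ∫ y, (R v : Y → ℂ) y * w y ∂μ = ∫ y, (v : Y → ℂ) y * w (F y) ∂μ)
    -- `Rₙ v = R (1_{φ = n} v)`, bounded on `B(Y)`
    (Rn : ℕ → B →L[ℂ] B) (hRn0 : Rn 0 = 0)
    (hRnR : ∀ n : ℕ, 1 ≤ n → ∀ b : B, ∀ g : Lp ℂ 1 μ,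
      ⇑g =ᵐ[μ] {y | φ y = n}.indicator ⇑(ι b) →
      ⇑(ι (Rn n b)) =ᵐ[μ] ⇑(R g))
    -- hypothesis (*)
    (hsum : Summable fun j : ℕ => ‖Rn j‖)
    (hstar : Summable fun n : ℕ => ∑' j : ℕ, ‖Rn (n + 1 + j)‖)
    -- hypothesis (H2)
    (P : B →L[ℂ] B)
    (hP : ∀ b : B, P b = (∫ y, (ι b : Y → ℂ) y ∂μ) • one)
    (hRP : (Rcal Rn 1).comp P = P) (hPR : P.comp (Rcal Rn 1) = P)
    (hspec1 : IsUnit (1 - Rcal Rn 1 + P))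
    (hspec2 : ∀ z : ℂ, ‖z‖ ≤ 1 → z ≠ 1 → IsUnit (1 - Rcal Rn z))

    (a : ℕ → ℝ) (ha : ∀ k, 0 < a k)
    (haS : Tendsto (fun k => a k * Sq Rn 0 k (a k)) atTop (nhds 0))
    (δ₀ : ℝ) (hδ₀ : 0 < δ₀) (k₁ : ℕ) (hk₁ : 1 ≤ k₁) (C₀ : ℝ) (hC₀ : 0 < C₀)
    (lam : ℕ → ℂ → ℂ) (Pz : ℕ → ℂ → B →L[ℂ] B)
    (hlam_an : ∀ k, k₁ ≤ k →
      AnalyticOnNhd ℂ (lam k) (Metric.ball (0 : ℂ) (Real.exp (a k)) ∩ Metric.ball (1 : ℂ) δ₀))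
    (hPz_an : ∀ k, k₁ ≤ k →
      AnalyticOnNhd ℂ (Pz k) (Metric.ball (0 : ℂ) (Real.exp (a k)) ∩ Metric.ball (1 : ℂ) δ₀))
    (hlam1 : ∀ k, k₁ ≤ k → lam k 1 = 1) (hPz1 : ∀ k, k₁ ≤ k → Pz k 1 = P)
    (heig : ∀ k, k₁ ≤ k →
      ∀ z ∈ Metric.ball (0 : ℂ) (Real.exp (a k)) ∩ Metric.ball (1 : ℂ) δ₀,
        Rcaltr Rn k z * Pz k z = lam k z • Pz k z ∧
        Pz k z * Rcaltr Rn k z = lam k z • Pz k z ∧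
        Pz k z * Pz k z = Pz k z ∧
        (∃ (ψ : B →L[ℂ] ℂ) (b : B), ∀ x : B, Pz k z x = ψ x • b) ∧
        ‖lam k z‖ ≤ C₀ ∧ ‖Pz k z‖ ≤ C₀) :
    ∃ δ : ℝ, 0 < δ ∧ δ ≤ δ₀ ∧ ∃ k₀ : ℕ, k₁ ≤ k₀ ∧ ∃ C : ℝ, 0 < C ∧
      ∀ k, k₀ ≤ k →
        ∃ (P1 : ℂ → B →L[ℂ] B) (lam1 : ℂ → ℂ),
          AnalyticOnNhd ℂ P1 (Metric.ball (0 : ℂ) (Real.exp (a k)) ∩ Metric.ball (1 : ℂ) δ) ∧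
          AnalyticOnNhd ℂ lam1 (Metric.ball (0 : ℂ) (Real.exp (a k)) ∩ Metric.ball (1 : ℂ) δ) ∧
          ∀ z ∈ Metric.ball (0 : ℂ) (Real.exp (a k)) ∩ Metric.ball (1 : ℂ) δ,
            (z - 1) • P1 z = Pz k z - P ∧
            (z - 1) * lam1 z = lam k z - 1 ∧
            ‖P1 z‖ ≤ C * ‖R1tr Rn k z‖ ∧
            ‖lam1 z‖ ≤ C * ‖R1tr Rn k z‖ ∧
            ‖lam1 z - lam1 1‖ ≤ C * (‖Rttr Rn k z‖ + ‖z - 1‖ * ‖R1tr Rn k z‖ ^ 2) := by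
  set A := Rcal Rn 1
  have hPone : P one = one := by
    have h : ∫ y, (ι one : Y → ℂ) y ∂μ = 1 := by
      rw [integral_congr_ae hone]
      simp
    rw [hP, h, one_smul]
  have hone0 : one ≠ 0 := by
    rintro rfl
    rw [map_zero] at hone
    have h : ∀ᵐ _ ∂μ, (0 : ℂ) = 1 := by
      filter_upwards [hone, Lp.coeFn_zero ℂ 1 μ] with y h1 h2
      rw [← h1, h2, Pi.zero_apply]
    exact IsProbabilityMeasure.ne_zero μ (by simpa using h)
  have hrank : ∀ T : B →L[ℂ] B, ∃ c : ℂ, P * T * P = c • P := by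
    intro T
    refine ⟨∫ y, (ι (T one) : Y → ℂ) y ∂μ, ContinuousLinearMap.ext fun b => ?_⟩
    change P (T (P b)) = (∫ y, (ι (T one) : Y → ℂ) y ∂μ) • P b
    rw [hP b, map_smul, map_smul, hP (T one), smul_comm]
  have hPP : P * P = P := by
    refine ContinuousLinearMap.ext fun b => ?_
    change P (P b) = P b
    rw [hP b, map_smul, hPone]
  have hP0 : P ≠ 0 := by
    rintro rfl
    exact hone0 hPone.symm
  obtain ⟨u, hu⟩ := hspec1
  have hG : (↑u⁻¹ : B →L[ℂ] B) * (1 - A + P) = 1 := by rw [← hu, u.inv_mul]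
  have hG' : (1 - A + P) * (↑u⁻¹ : B →L[ℂ] B) = 1 := by rw [← hu, u.mul_inv]
  obtain ⟨ε, K, hε, hK, hmain⟩ :=
    exists_perturbation_bounds (A := A) hPR hRP hPP hP0 hG hG' hrank hC₀.le
  set M := ∑' n : ℕ, ∑' j : ℕ, ‖Rn (n + 1 + j)‖
  have hM : 0 ≤ M := tsum_nonneg fun n => tsum_nonneg fun j => norm_nonneg _
  obtain ⟨k₂, hk₂⟩ := eventually_atTop.1
    (haS.eventually_lt_const (show (0 : ℝ) < ε / 4 by positivity))
  set δ := min (min δ₀ 1) (ε / (6 * (M + 1)))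
  have hδ : 0 < δ := by positivity
  have hδδ₀ : δ ≤ δ₀ := (min_le_left _ _).trans (min_le_left _ _)
  have hδ1 : δ ≤ 1 := (min_le_left _ _).trans (min_le_right _ _)
  have hδM : 3 * δ * M ≤ ε / 2 := by
    have h := (le_div_iff₀ (by positivity : (0 : ℝ) < 6 * (M + 1))).1
      (min_le_right (min δ₀ 1) (ε / (6 * (M + 1))))
    change δ * _ ≤ _ at h
    linarith
  refine ⟨δ, hδ, hδδ₀, max k₁ k₂, le_max_left _ _,
    1 + K + (‖P‖ ^ 2 + ‖P‖ * K + ‖P‖ * K ^ 2), by positivity, fun k hk => ?_⟩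
  have hkk₁ : k₁ ≤ k := (le_max_left _ _).trans hk
  have hkk₂ : k₂ ≤ k := (le_max_right _ _).trans hk
  set s := ball (0 : ℂ) (Real.exp (a k)) ∩ ball (1 : ℂ) δ with hs
  have hss : s ⊆ ball (0 : ℂ) (Real.exp (a k)) ∩ ball (1 : ℂ) δ₀ :=
    inter_subset_inter_right _ (ball_subset_ball hδδ₀)
  have hso : IsOpen s := isOpen_ball.inter isOpen_ball
  have hsc : IsPreconnected s := ((convex_ball _ _).inter (convex_ball _ _)).isPreconnected
  have h1s : (1 : ℂ) ∈ s := ⟨by simp [ha k], by simp [hδ]⟩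
  have hPan := (hPz_an k hkk₁).mono hss
  have hlan := (hlam_an k hkk₁).mono hss
  have hPd := hPan.dslope_of_isOpen hso h1s
  have hld := hlan.dslope_of_isOpen hso h1s
  have hRtr := Rcaltr_eq_add_smul_R1tr hsum k
  have hbounds := hmain s hsc 1 h1s (lam k) (Pz k) (fun z => (z - 1) • R1tr Rn k z)
    hlan.continuousOn hPan.continuousOn (hlam1 k hkk₁) (hPz1 k hkk₁) fun z hz => by
      obtain ⟨h1, h2, h3, -, -, h4⟩ := heig k hkk₁ z (hss hz)
      rw [hRtr] at h1 h2
      refine ⟨h1, h2, h3, h4, (norm_smul_R1tr_le hsum hstar k (ha k) hδ1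
        (by simpa using hz.1) (by simpa [dist_eq_norm] using hz.2)).trans ?_⟩
      have := hk₂ k hkk₂
      linarith
  have hPsub : ∀ z, (z - 1) • dslope (Pz k) 1 z = Pz k z - P := fun z => by
    rw [sub_smul_dslope, hPz1 k hkk₁]
  have hlsub : ∀ z, (z - 1) * dslope (lam k) 1 z = lam k z - 1 := fun z => by
    rw [← smul_eq_mul, sub_smul_dslope, hlam1 k hkk₁]
  have hPc : ContinuousAt (dslope (Pz k) 1) 1 := (hPd 1 h1s).continuousAt
  have hlc : ContinuousAt (dslope (lam k) 1) 1 := (hld 1 h1s).continuousAt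
  have hRc := continuous_R1tr Rn k
  have hquot : ∀ z ∈ s, ‖dslope (Pz k) 1 z‖ ≤ K * ‖R1tr Rn k z‖ ∧
      ‖dslope (lam k) 1 z‖ ≤ K * ‖R1tr Rn k z‖ := by
    have hne : ∀ z ∈ s, z ≠ 1 → ‖dslope (Pz k) 1 z‖ ≤ K * ‖R1tr Rn k z‖ ∧
        ‖dslope (lam k) 1 z‖ ≤ K * ‖R1tr Rn k z‖ := by
      intro z hz hz1
      have ht : 0 < ‖z - 1‖ := norm_pos_iff.2 (sub_ne_zero.2 hz1)
      obtain ⟨h1, h2⟩ := hbounds z hz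
      rw [← hlsub, norm_mul, norm_smul] at h1
      rw [← hPsub, norm_smul, norm_smul] at h2
      constructor <;> refine le_of_mul_le_mul_left ?_ ht <;> linarith
    intro z hz
    rcases eq_or_ne z 1 with rfl | hz1
    · have hRc1 : ContinuousAt (fun z => K * ‖R1tr Rn k z‖) 1 := by fun_prop
      exact ⟨le_at_of_le_punctured (hso.mem_nhds h1s) hPc.norm hRc1 fun z hz h => (hne z hz h).1,
        le_at_of_le_punctured (hso.mem_nhds h1s) hlc.norm hRc1 fun z hz h => (hne z hz h).2⟩
    · exact hne z hz hz1
  have hPzeq : ∀ z, Pz k z = P + (z - 1) • dslope (Pz k) 1 z := fun z => by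
    rw [hPsub, add_sub_cancel]
  have hcompr : ∀ z ∈ s, dslope (lam k) 1 z • (P * Pz k z) = P * R1tr Rn k z * Pz k z := by
    have hne : ∀ z ∈ s, z ≠ 1 →
        dslope (lam k) 1 z • (P * Pz k z) = P * R1tr Rn k z * Pz k z := by
      intro z hz hz1
      have h1 := (heig k hkk₁ z (hss hz)).1
      rw [hRtr] at h1
      refine smul_right_injective _ (sub_ne_zero.2 hz1) ?_
      have h2 : P * ((A + (z - 1) • R1tr Rn k z) * Pz k z) =
          P * A * Pz k z + (z - 1) • (P * R1tr Rn k z * Pz k z) := by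
        rw [add_mul, mul_add, smul_mul_assoc, mul_smul_comm, mul_assoc, mul_assoc]
      have hPA : P * A = P := hPR
      rw [h1, hPA, mul_smul_comm] at h2
      change (z - 1) • _ = (z - 1) • _
      rw [smul_smul, hlsub, sub_smul, one_smul, h2, add_sub_cancel_left]
    intro z hz
    rcases eq_or_ne z 1 with rfl | hz1
    · have hPzc : ContinuousAt (Pz k) 1 := (hPan 1 h1s).continuousAt
      have hc : ContinuousAt
          (fun z => ‖dslope (lam k) 1 z • (P * Pz k z) - P * R1tr Rn k z * Pz k z‖) 1 :=
        ((hlc.smul (continuousAt_const.mul hPzc)).sub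
          ((continuousAt_const.mul hRc.continuousAt).mul hPzc)).norm
      have h := le_at_of_le_punctured (hso.mem_nhds h1s) hc (continuousAt_const (y := (0 : ℝ)))
        fun z hz h => by simp [hne z hz h]
      exact sub_eq_zero.1 (norm_le_zero_iff.1 h)
    · exact hne z hz hz1
  have hbase : dslope (lam k) 1 1 • P = P * R1tr Rn k 1 * P := by
    have h := hcompr 1 h1s
    rwa [hPz1 k hkk₁, hPP] at h
  refine ⟨dslope (Pz k) 1, dslope (lam k) 1, hPd, hld, fun z hz => ?_⟩
  obtain ⟨hq1, hq2⟩ := hquot z hz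
  have hz1 := hcompr z hz
  rw [hPzeq z] at hz1
  have hb := norm_quotient_sub_le hPP hP0 hK hz1 hbase hq2 hq1
  have hc0 : 0 ≤ ‖P‖ ^ 2 + ‖P‖ * K + ‖P‖ * K ^ 2 := by positivity
  have hKC : K * ‖R1tr Rn k z‖ ≤
      (1 + K + (‖P‖ ^ 2 + ‖P‖ * K + ‖P‖ * K ^ 2)) * ‖R1tr Rn k z‖ := by
    gcongr
    linarith
  refine ⟨hPsub z, hlsub z, hq1.trans hKC, hq2.trans hKC, hb.trans ?_⟩
  exact mul_le_mul_of_nonneg_right (by linarith) (by positivity)
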